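/- arXiv:2301.09134 — 3 statements merged into one kernel-verified Lean document; each statement's English description precedes it below -/
import Mathlib

section
/- Let F0 satisfy Assumption (A) and let β ∈ (0, 1/2). Then for all sufficiently large c > 0, the function F_{β,c} belongs to C¹_b(ℝ; [0,∞)) (i.e. F_{β,c} is continuously differentiable, nonnegative, and F_{β,c} and F_{β,c}' are bounded), and the function g_{β,c}(r) = 4π√2 ∫₀^∞ √s F_{β,c}(r+s) ds satisfies Conditions (G) with exponent α = 3/2 − β. -/
open MeasureTheory Real Set

noncomputable section

abbrev R3 : Type := EuclideanSpace ℝ (Fin 3)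

/-- g(r) = 4π√2 ∫₀^∞ √s F(r+s) ds -/
def gfun (F : ℝ → ℝ) (r : ℝ) : ℝ :=
  4 * π * Real.sqrt 2 * ∫ s in Ioi (0:ℝ), Real.sqrt s * F (r + s)

/-- Conditions (G) on g with exponent α. -/
def CondG (g : ℝ → ℝ) (α : ℝ) : Prop :=
  g 0 = 1 ∧
  ContDiff ℝ 2 g ∧
  (∀ r : ℝ, deriv g r < 0) ∧
  (∀ r : ℝ, g 0 + deriv g 0 * r ≤ g r) ∧
  ∃ C₁ : ℝ, 0 < C₁ ∧ ∃ C₂ : ℝ, 0 < C₂ ∧ ∀ r : ℝ,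
    g r - (g 0 + deriv g 0 * r) ≤ C₁ * |r| ^ α ∧
    |deriv g r - deriv g 0| ≤ C₂ * |r| ^ (α - 1)

/-- Assumption (A) on F0, with F0' its derivative on [0,∞). -/
def AssumptionA (F0 F0' : ℝ → ℝ) : Prop :=
  (∀ r, 0 ≤ r → 0 ≤ F0 r) ∧
  (∀ r, 0 ≤ r → HasDerivWithinAt F0 (F0' r) (Ici 0) r) ∧
  ContinuousOn F0' (Ici 0) ∧
  4 * π * Real.sqrt 2 * (∫ r in Ioi (0:ℝ), Real.sqrt r * F0 r) = 1 ∧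
  (∃ C : ℝ, 0 < C ∧ ∀ r, 0 ≤ r → |F0 r| + |F0' r| ≤ C / (1 + r ^ 3)) ∧
  (∀ r, 0 ≤ r → F0' r < 0)

/-- C¹_b : continuously differentiable, bounded together with the derivative. -/
def C1b (F : ℝ → ℝ) : Prop :=
  ContDiff ℝ 1 F ∧ ∃ M : ℝ, ∀ r : ℝ, |F r| ≤ M ∧ |deriv F r| ≤ M

/-- The Laplacian of φ at x. -/
def lap (φ : R3 → ℝ) (x : R3) : ℝ :=
  ∑ i : Fin 3, fderiv ℝ (fun y => fderiv ℝ φ y (EuclideanSpace.single i 1)) x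
    (EuclideanSpace.single i 1)

/-- Integral of φ against a signed measure. -/
def sintegral (μ : SignedMeasure R3) (φ : R3 → ℝ) : ℝ :=
  (∫ x, φ x ∂μ.toJordanDecomposition.posPart) -
  (∫ x, φ x ∂μ.toJordanDecomposition.negPart)

/-- φ is a C_c^∞ test function. -/
def IsTest (φ : R3 → ℝ) : Prop := ContDiff ℝ (⊤ : ℕ∞) φ ∧ HasCompactSupport φ

/-- Q is a weak solution of −ΔQ = g∘Q − 1 + μ. -/
def WeakSol (g : ℝ → ℝ) (μ : SignedMeasure R3) (Q : R3 → ℝ) : Prop :=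
  ∀ φ : R3 → ℝ, IsTest φ →
    -(∫ x, Q x * lap φ x) = (∫ x, (g (Q x) - 1) * φ x) + sintegral μ φ

/-- Q has a distributional gradient in L¹(ℝ³). -/
def HasL1Grad (Q : R3 → ℝ) : Prop :=
  ∃ G : R3 → EuclideanSpace ℝ (Fin 3), Integrable G ∧
    ∀ φ : R3 → ℝ, IsTest φ → ∀ i : Fin 3,
      ∫ x, Q x * fderiv ℝ φ x (EuclideanSpace.single i 1) = -∫ x, G x i * φ x

/-- The extension F_{β,c} of F0 to the negative half-line. -/
def Fbc (F0 F0' : ℝ → ℝ) (β c : ℝ) (r : ℝ) : ℝ :=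
  if 0 ≤ r then F0 r
  else c * r ^ 2 / (1 + r ^ 2) ^ ((β + 2) / 2) + Real.exp (-r ^ 2) * (F0 0 + F0' 0 * r)

/-- The Yukawa kernel Φ_σ, fundamental solution of σ − Δ on ℝ³. -/
def Phi (σ : ℝ) (x : R3) : ℝ := Real.exp (-Real.sqrt σ * ‖x‖) / (4 * π * ‖x‖)

/-- Convolution of Φ_σ with a signed measure μ. -/
def convPhiMeas (σ : ℝ) (μ : SignedMeasure R3) (x : R3) : ℝ :=
  (∫ y, Phi σ (x - y) ∂μ.toJordanDecomposition.posPart) -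
  (∫ y, Phi σ (x - y) ∂μ.toJordanDecomposition.negPart)

/-- Bounded on the negative half-line, cubically decaying on the positive one. -/
def CubicDecay (f : ℝ → ℝ) (A : ℝ) : Prop := ∀ x, |f x| ≤ A / (1 + max x 0) ^ 3

/-- Weights on `(0,∞)` against which cubically decaying functions are integrable. -/
def CubicWeight (w : ℝ → ℝ) : Prop :=
  Measurable w ∧ (∀ s, 0 ≤ w s) ∧ IntegrableOn (fun s => w s / (1 + s) ^ 3) (Ioi 0)

lemma CubicDecay.nonneg {f : ℝ → ℝ} {A : ℝ} (hf : CubicDecay f A) : 0 ≤ A := by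
  have h := hf 0
  simp at h
  exact (abs_nonneg _).trans h

lemma CubicDecay.abs_le {f : ℝ → ℝ} {A : ℝ} (hf : CubicDecay f A) (x : ℝ) : |f x| ≤ A := by
  refine (hf x).trans (div_le_self hf.nonneg ?_)
  exact one_le_pow₀ (by linarith [le_max_right x 0])

lemma CubicDecay.shift {f : ℝ → ℝ} {A R r s : ℝ} (hf : CubicDecay f A) (hR : 0 ≤ R)
    (hr : -R ≤ r) (hs : 0 ≤ s) : |f (r + s)| ≤ A * (1 + R) ^ 3 / (1 + s) ^ 3 := by
  refine (hf (r + s)).trans ?_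
  have h0 := le_max_right (r + s) 0
  have h1 := le_max_left (r + s) 0
  rw [div_le_div_iff₀ (by positivity) (by positivity), mul_assoc, ← mul_pow]
  refine mul_le_mul_of_nonneg_left (pow_le_pow_left₀ (by positivity) ?_ 3) hf.nonneg
  nlinarith

lemma abs_weight_mul_le {w f : ℝ → ℝ} {A R r s : ℝ} (hw : CubicWeight w) (hf : CubicDecay f A)
    (hR : 0 ≤ R) (hr : -R ≤ r) (hs : 0 ≤ s) :
    ‖w s * f (r + s)‖ ≤ A * (1 + R) ^ 3 * (w s / (1 + s) ^ 3) := by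
  rw [Real.norm_eq_abs, abs_mul, abs_of_nonneg (hw.2.1 s)]
  calc w s * |f (r + s)| ≤ w s * (A * (1 + R) ^ 3 / (1 + s) ^ 3) :=
        mul_le_mul_of_nonneg_left (hf.shift hR hr hs) (hw.2.1 s)
    _ = _ := by ring

lemma weight_mul_aestronglyMeasurable {w f : ℝ → ℝ} (hw : CubicWeight w) (hc : Continuous f)
    (r : ℝ) (μ : Measure ℝ) : AEStronglyMeasurable (fun s => w s * f (r + s)) μ :=
  (hw.1.mul (hc.comp (continuous_const.add continuous_id)).measurable).aestronglyMeasurable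

lemma integrableOn_weight_mul {w f : ℝ → ℝ} {A : ℝ} (hw : CubicWeight w) (hc : Continuous f)
    (hf : CubicDecay f A) (r : ℝ) : IntegrableOn (fun s => w s * f (r + s)) (Ioi 0) := by
  refine Integrable.mono' (hw.2.2.const_mul (A * (1 + |r|) ^ 3))
    (weight_mul_aestronglyMeasurable hw hc r _) ?_
  filter_upwards [ae_restrict_mem measurableSet_Ioi] with s hs
  exact abs_weight_mul_le hw hf (abs_nonneg r) (neg_abs_le r) (le_of_lt hs)

lemma neg_abs_add_one_le_of_mem_ball {r x : ℝ} (hx : x ∈ Metric.ball r 1) : -(|r| + 1) ≤ x := by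
  rw [Metric.mem_ball, Real.dist_eq] at hx
  have h1 := abs_lt.1 hx
  have h2 := neg_abs_le r
  linarith

lemma continuous_integral_weight_mul {w f : ℝ → ℝ} {A : ℝ} (hw : CubicWeight w)
    (hc : Continuous f) (hf : CubicDecay f A) :
    Continuous fun r => ∫ s in Ioi (0:ℝ), w s * f (r + s) := by
  rw [continuous_iff_continuousAt]
  intro r
  refine continuousAt_of_dominated
    (bound := fun s => A * (1 + (|r| + 1)) ^ 3 * (w s / (1 + s) ^ 3))
    (Filter.Eventually.of_forall fun x => weight_mul_aestronglyMeasurable hw hc x _) ?_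
    (hw.2.2.const_mul _) ?_
  · filter_upwards [Metric.ball_mem_nhds r one_pos] with x hx
    filter_upwards [ae_restrict_mem measurableSet_Ioi] with s hs
    exact abs_weight_mul_le hw hf (by positivity) (neg_abs_add_one_le_of_mem_ball hx) (le_of_lt hs)
  · refine Filter.Eventually.of_forall fun s => Continuous.continuousAt ?_
    exact continuous_const.mul (hc.comp (continuous_id.add continuous_const))

lemma hasDerivAt_integral_weight_mul {w f f' : ℝ → ℝ} {A A' : ℝ} (hw : CubicWeight w)
    (hd : ∀ x, HasDerivAt f (f' x) x) (hc' : Continuous f') (hf : CubicDecay f A)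
    (hf' : CubicDecay f' A') (r : ℝ) :
    HasDerivAt (fun r => ∫ s in Ioi (0:ℝ), w s * f (r + s))
      (∫ s in Ioi (0:ℝ), w s * f' (r + s)) r := by
  have hc : Continuous f := continuous_iff_continuousAt.2 fun x => (hd x).continuousAt
  refine (hasDerivAt_integral_of_dominated_loc_of_deriv_le (Metric.ball_mem_nhds r one_pos)
    (bound := fun s => A' * (1 + (|r| + 1)) ^ 3 * (w s / (1 + s) ^ 3))
    (F' := fun r s => w s * f' (r + s))
    (Filter.Eventually.of_forall fun x => weight_mul_aestronglyMeasurable hw hc x _)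
    (integrableOn_weight_mul hw hc hf r) (weight_mul_aestronglyMeasurable hw hc' r _) ?_
    (hw.2.2.const_mul _) ?_).2
  · filter_upwards [ae_restrict_mem measurableSet_Ioi] with s hs x hx
    exact abs_weight_mul_le hw hf' (by positivity) (neg_abs_add_one_le_of_mem_ball hx) (le_of_lt hs)
  · refine Filter.Eventually.of_forall fun s x _ => ?_
    exact ((hd (x + s)).comp_add_const x s).const_mul (w s)

lemma inv_sqrt_eq_rpow {s : ℝ} (hs : 0 ≤ s) : (√s)⁻¹ = s ^ (-(1 / 2) : ℝ) := by
  rw [Real.rpow_neg hs, Real.sqrt_eq_rpow]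

lemma integrableOn_inv_sqrt {d : ℝ} (hd : 0 ≤ d) :
    IntegrableOn (fun s => (√s)⁻¹) (Ioc 0 d) := by
  have h := (intervalIntegrable_iff_integrableOn_Ioc_of_le hd).1
    (intervalIntegral.intervalIntegrable_rpow' (a := 0) (b := d) (r := -(1 / 2)) (by norm_num))
  exact h.congr_fun (fun s hs => (inv_sqrt_eq_rpow hs.1.le).symm) measurableSet_Ioc

lemma integral_inv_sqrt {d : ℝ} (hd : 0 ≤ d) : ∫ s in Ioc 0 d, (√s)⁻¹ = 2 * √d := by
  rw [setIntegral_congr_fun measurableSet_Ioc fun s hs => inv_sqrt_eq_rpow (le_of_lt hs.1),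
    ← intervalIntegral.integral_of_le hd, integral_rpow (Or.inl (by norm_num)),
    Real.sqrt_eq_rpow]
  norm_num
  ring

lemma integrableOn_inv_sqrt_div : IntegrableOn (fun s => (√s)⁻¹ / (1 + s) ^ 2) (Ioi 0) := by
  rw [← Ioc_union_Ioi_eq_Ioi (zero_le_one' ℝ)]
  have hm : Measurable fun s : ℝ => (√s)⁻¹ / (1 + s) ^ 2 := by fun_prop
  refine IntegrableOn.union ?_ ?_
  · refine Integrable.mono' (integrableOn_inv_sqrt zero_le_one) hm.aestronglyMeasurable ?_
    filter_upwards [ae_restrict_mem measurableSet_Ioc] with s hs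
    have := hs.1
    rw [Real.norm_eq_abs, abs_of_nonneg (by positivity)]
    exact div_le_self (by positivity) (one_le_pow₀ (by linarith))
  · refine Integrable.mono' (integrableOn_Ioi_rpow_of_lt (a := -2) (by norm_num) one_pos)
      hm.aestronglyMeasurable ?_
    filter_upwards [ae_restrict_mem measurableSet_Ioi] with s hs
    have hs : (1:ℝ) < s := hs
    have h1 : 1 ≤ √s := by rw [Real.one_le_sqrt]; exact hs.le
    rw [Real.norm_eq_abs, abs_of_nonneg (by positivity), Real.rpow_neg (by linarith)]
    norm_cast
    rw [div_eq_mul_inv]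
    calc (√s)⁻¹ * ((1 + s) ^ 2)⁻¹ ≤ 1 * (s ^ 2)⁻¹ := by
          gcongr
          · exact inv_le_one_of_one_le₀ h1
          · linarith
      _ = _ := one_mul _

lemma cubicWeight_inv_sqrt : CubicWeight fun s => (√s)⁻¹ := by
  refine ⟨by fun_prop, fun s => by positivity, ?_⟩
  have hm : Measurable fun s : ℝ => (√s)⁻¹ / (1 + s) ^ 3 := by fun_prop
  refine Integrable.mono' integrableOn_inv_sqrt_div hm.aestronglyMeasurable ?_
  filter_upwards [ae_restrict_mem measurableSet_Ioi] with s hs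
  have hs : (0:ℝ) < s := hs
  rw [Real.norm_eq_abs, abs_of_nonneg (by positivity)]
  gcongr <;> linarith

lemma cubicWeight_sqrt : CubicWeight fun s => √s := by
  refine ⟨by fun_prop, fun s => by positivity, ?_⟩
  have hm : Measurable fun s : ℝ => √s / (1 + s) ^ 3 := by fun_prop
  refine Integrable.mono' integrableOn_inv_sqrt_div hm.aestronglyMeasurable ?_
  filter_upwards [ae_restrict_mem measurableSet_Ioi] with s hs
  have hs : (0:ℝ) < s := hs
  rw [Real.norm_eq_abs, abs_of_nonneg (by positivity),
    div_le_div_iff₀ (by positivity) (by positivity)]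
  have h1 : √s = (√s)⁻¹ * s := by
    rw [eq_inv_mul_iff_mul_eq₀ (by positivity)]; exact Real.mul_self_sqrt hs.le
  calc √s * (1 + s) ^ 2 = (√s)⁻¹ * (s * (1 + s) ^ 2) := by rw [← mul_assoc, ← h1]
    _ ≤ (√s)⁻¹ * (1 + s) ^ 3 := by gcongr; nlinarith [sq_nonneg (1 + s)]

lemma integral_sqrt_mul_deriv {f f' : ℝ → ℝ} {A A' : ℝ}
    (hd : ∀ x, HasDerivAt f (f' x) x) (hc' : Continuous f') (hf : CubicDecay f A)
    (hf' : CubicDecay f' A') (r : ℝ) :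
    ∫ s in Ioi (0:ℝ), √s * f' (r + s) = -(1 / 2) * ∫ s in Ioi (0:ℝ), (√s)⁻¹ * f (r + s) := by
  have hc : Continuous f := continuous_iff_continuousAt.2 fun x => (hd x).continuousAt
  have h1 := integrableOn_weight_mul cubicWeight_sqrt hc' hf' r
  have h2 := (integrableOn_weight_mul cubicWeight_inv_sqrt hc hf r).const_mul (1 / 2)
  have h3 := integral_Ioi_of_hasDerivAt_of_tendsto (a := 0) (m := 0)
    (f := fun s => √s * f (r + s))
    (f' := fun s => 1 / 2 * ((√s)⁻¹ * f (r + s)) + √s * f' (r + s))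
    (Continuous.continuousWithinAt (by fun_prop)) ?_ (h2.add h1) ?_
  · rw [integral_add h2 h1, integral_const_mul] at h3
    simp only [Real.sqrt_zero, zero_mul, sub_zero] at h3
    linarith
  · intro s hs
    have hs : (0:ℝ) < s := hs
    have h4 := (Real.hasDerivAt_sqrt hs.ne').mul ((hd (r + s)).comp_const_add r s)
    refine h4.congr_deriv ?_
    rw [one_div, mul_inv]
    ring
  · have hlim : Filter.Tendsto (fun s : ℝ => A * (1 + |r|) ^ 3 / s) Filter.atTop (nhds 0) :=
      Filter.Tendsto.const_div_atTop Filter.tendsto_id _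
    refine squeeze_zero_norm' ?_ hlim
    filter_upwards [Filter.eventually_ge_atTop 1] with s hs
    refine (abs_weight_mul_le cubicWeight_sqrt hf (abs_nonneg r) (neg_abs_le r)
      (by linarith)).trans ?_
    have hA := hf.nonneg
    rw [div_eq_mul_inv _ s]
    refine mul_le_mul_of_nonneg_left ?_ (by positivity)
    have h5 : √s ≤ s := Real.sqrt_le_iff.2 ⟨by linarith, by nlinarith⟩
    rw [inv_eq_one_div, div_le_div_iff₀ (by positivity) (by positivity)]
    nlinarith [pow_nonneg (zero_le_one.trans hs) 3]

/-- The half-order potential `∫₀^∞ s^{-1/2} F(r+s) ds`, proportional to `-g'`. -/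
def halfPot (F : ℝ → ℝ) (r : ℝ) : ℝ := ∫ s in Ioi (0:ℝ), (√s)⁻¹ * F (r + s)

lemma integral_Ioi_comp_add (f : ℝ → ℝ) (d : ℝ) :
    ∫ s in Ioi (0:ℝ), f (s + d) = ∫ s in Ioi d, f s := by
  have h := (measurePreserving_add_right volume d).setIntegral_preimage_emb
    (measurableEmbedding_addRight d) f (Ioi d)
  simpa using h

lemma halfPot_le_add {F : ℝ → ℝ} {A : ℝ} (hc : Continuous F) (hF : CubicDecay F A)
    (hpos : ∀ x, 0 ≤ F x) (r : ℝ) {d : ℝ} (hd : 0 ≤ d) :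
    halfPot F r ≤ (∫ s in Ioc 0 d, (√s)⁻¹ * F (r + s)) + halfPot F (r + d) := by
  have hi := integrableOn_weight_mul cubicWeight_inv_sqrt hc hF r
  have hsplit : halfPot F r = (∫ s in Ioc 0 d, (√s)⁻¹ * F (r + s)) +
      ∫ s in Ioi d, (√s)⁻¹ * F (r + s) := by
    rw [halfPot, ← Ioc_union_Ioi_eq_Ioi hd]
    refine setIntegral_union ?_ measurableSet_Ioi (hi.mono_set Ioc_subset_Ioi_self)
      (hi.mono_set (Ioi_subset_Ioi hd))
    exact Set.disjoint_left.2 fun x hx hx' => not_lt.2 hx.2 hx'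
  rw [hsplit, ← integral_Ioi_comp_add (fun s => (√s)⁻¹ * F (r + s)) d]
  refine add_le_add_right ?_ _
  refine integral_mono_of_nonneg
    (Filter.Eventually.of_forall fun s => mul_nonneg (by positivity) (hpos _))
    (integrableOn_weight_mul cubicWeight_inv_sqrt hc hF (r + d)) ?_
  filter_upwards [ae_restrict_mem measurableSet_Ioi] with s hs
  have hs : (0:ℝ) < s := hs
  have he : r + (s + d) = r + d + s := by ring
  simp only [he]
  refine mul_le_mul_of_nonneg_right ?_ (hpos _)
  gcongr
  linarith

lemma halfPot_pos {F : ℝ → ℝ} {A : ℝ} (hc : Continuous F) (hF : CubicDecay F A)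
    (hpos : ∀ x, 0 < F x) (r : ℝ) : 0 < halfPot F r := by
  have hi := integrableOn_weight_mul cubicWeight_inv_sqrt hc hF r
  refine (setIntegral_pos_iff_support_of_nonneg_ae
    (Filter.Eventually.of_forall fun s => mul_nonneg (by positivity) (hpos _).le) hi).2 ?_
  have hsub : Ioi (0:ℝ) ⊆ Function.support (fun s => (√s)⁻¹ * F (r + s)) ∩ Ioi 0 := by
    intro s hs
    have hs' : (0:ℝ) < s := hs
    exact ⟨(mul_pos (by positivity) (hpos _)).ne', hs⟩
  exact lt_of_lt_of_le (by simp) (measure_mono hsub)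

lemma halfPot_mono {F : ℝ → ℝ} {A a b : ℝ} (hc : Continuous F) (hF : CubicDecay F A)
    (h : ∀ s, 0 < s → F (a + s) ≤ F (b + s)) : halfPot F a ≤ halfPot F b := by
  refine setIntegral_mono_on (integrableOn_weight_mul cubicWeight_inv_sqrt hc hF a)
    (integrableOn_weight_mul cubicWeight_inv_sqrt hc hF b) measurableSet_Ioi fun s hs => ?_
  exact mul_le_mul_of_nonneg_left (h s hs) (by positivity)

lemma halfPot_sub_le_of_nonneg {F : ℝ → ℝ} {A : ℝ} (hc : Continuous F) (hF : CubicDecay F A)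
    (hpos : ∀ x, 0 ≤ F x) {r : ℝ} (hr : 0 ≤ r) : halfPot F 0 - halfPot F r ≤ 2 * A * √r := by
  have h1 := halfPot_le_add hc hF hpos 0 hr
  have h2 : (∫ s in Ioc 0 r, (√s)⁻¹ * F (0 + s)) ≤ ∫ s in Ioc 0 r, A * (√s)⁻¹ := by
    refine setIntegral_mono_on ((integrableOn_weight_mul cubicWeight_inv_sqrt hc hF 0).mono_set
      Ioc_subset_Ioi_self) ((integrableOn_inv_sqrt hr).const_mul A) measurableSet_Ioc
      fun s _ => ?_
    rw [mul_comm]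
    exact mul_le_mul_of_nonneg_right ((le_abs_self _).trans (hF.abs_le _)) (by positivity)
  rw [integral_const_mul, integral_inv_sqrt hr] at h2
  rw [zero_add] at h1
  linarith

lemma halfPot_neg_sub_le {F : ℝ → ℝ} {A D β : ℝ} (hc : Continuous F) (hF : CubicDecay F A)
    (hpos : ∀ x, 0 ≤ F x) (hβ : 0 < β) (hβ' : β < 1 / 2) (hD : 0 ≤ D)
    (hFD : ∀ x < 0, F x ≤ D * (-x) ^ (-β)) {u : ℝ} (hu : 0 < u) :
    halfPot F (-u) - halfPot F 0 ≤ 8 * D * u ^ (1 / 2 - β) := by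
  have h1 := halfPot_le_add hc hF hpos (-u) hu.le
  rw [neg_add_cancel] at h1
  have hi2 : IntervalIntegrable (fun s => (u - s) ^ (-β)) volume 0 u := by
    have := (intervalIntegral.intervalIntegrable_rpow' (a := u) (b := 0) (r := -β)
      (by linarith)).comp_sub_left u
    simpa using this
  have hi2' := (intervalIntegrable_iff_integrableOn_Ioc_of_le hu.le).1 hi2
  have hI : ∫ s in Ioc 0 u, (u - s) ^ (-β) = u ^ (1 - β) / (1 - β) := by
    rw [← intervalIntegral.integral_of_le hu.le,
      intervalIntegral.integral_comp_sub_left (fun x => x ^ (-β)) u,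
      integral_rpow (Or.inl (by linarith))]
    have : -β + 1 = 1 - β := by ring
    rw [this, sub_self, sub_zero, Real.zero_rpow (by linarith), sub_zero]
  have hint := ((integrableOn_inv_sqrt hu.le).const_mul ((u / 2) ^ (-β))).add
    (hi2'.const_mul (√(u / 2))⁻¹)
  have h2 : (∫ s in Ioc 0 u, (√s)⁻¹ * F (-u + s)) ≤
      ∫ s in Ioc 0 u, D * ((u / 2) ^ (-β) * (√s)⁻¹ + (√(u / 2))⁻¹ * (u - s) ^ (-β)) := by
    rw [integral_Ioc_eq_integral_Ioo, integral_Ioc_eq_integral_Ioo]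
    refine setIntegral_mono_on ((integrableOn_weight_mul cubicWeight_inv_sqrt hc hF (-u)).mono_set
      Ioo_subset_Ioi_self) (IntegrableOn.mono_set (hint.const_mul D) Ioo_subset_Ioc_self)
      measurableSet_Ioo fun s hs => ?_
    have hs0 : 0 < s := hs.1
    have hsu : 0 < u - s := sub_pos.2 hs.2
    have h3 := hFD (-u + s) (by linarith)
    have h4 : -(-u + s) = u - s := by ring
    rw [h4] at h3
    calc (√s)⁻¹ * F (-u + s) ≤ (√s)⁻¹ * (D * (u - s) ^ (-β)) :=
          mul_le_mul_of_nonneg_left h3 (by positivity)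
      _ = D * ((√s)⁻¹ * (u - s) ^ (-β)) := by ring
      _ ≤ _ := by
          refine mul_le_mul_of_nonneg_left ?_ hD
          rcases le_total s (u / 2) with h | h
          · have h5 : (u - s) ^ (-β) ≤ (u / 2) ^ (-β) :=
              Real.rpow_le_rpow_of_nonpos (by positivity) (by linarith) (by linarith)
            have h6 : 0 ≤ (√(u / 2))⁻¹ * (u - s) ^ (-β) := by positivity
            nlinarith [mul_le_mul_of_nonneg_left h5 (inv_nonneg.2 (Real.sqrt_nonneg s))]
          · have h5 : (√s)⁻¹ ≤ (√(u / 2))⁻¹ := by gcongr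
            have h6 : 0 ≤ (u / 2) ^ (-β) * (√s)⁻¹ := by positivity
            have h7 : 0 ≤ (u - s) ^ (-β) := by positivity
            nlinarith [mul_le_mul_of_nonneg_right h5 h7]
  rw [integral_const_mul, integral_add ((integrableOn_inv_sqrt hu.le).const_mul _)
    (hi2'.const_mul _), integral_const_mul, integral_const_mul, hI,
    integral_inv_sqrt hu.le] at h2
  have e1 : (u / 2) ^ (-β) * (2 * √u) ≤ 4 * u ^ (1 / 2 - β) := by
    have h8 : (u / 2) ^ (-β) = 2 ^ β * u ^ (-β) := by
      rw [Real.div_rpow hu.le (by norm_num), Real.rpow_neg (by norm_num : (0:ℝ) ≤ 2)]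
      field_simp
    have h9 : (2:ℝ) ^ β ≤ 2 := by
      calc (2:ℝ) ^ β ≤ 2 ^ (1:ℝ) := Real.rpow_le_rpow_of_exponent_le (by norm_num) (by linarith)
        _ = 2 := Real.rpow_one 2
    have h10 : u ^ (1 / 2 - β) = u ^ (-β) * √u := by
      rw [Real.sqrt_eq_rpow, ← Real.rpow_add hu]; congr 1; ring
    rw [h8, h10]
    have : 0 ≤ u ^ (-β) * √u := by positivity
    nlinarith [mul_le_mul_of_nonneg_right h9 this]
  have e2 : (√(u / 2))⁻¹ * (u ^ (1 - β) / (1 - β)) ≤ 4 * u ^ (1 / 2 - β) := by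
    have h8 : u ^ (1 - β) = u ^ (1 / 2 - β) * √u := by
      rw [Real.sqrt_eq_rpow, ← Real.rpow_add hu]; congr 1; ring
    have h9 : √u ≤ 2 * √(u / 2) := by
      rw [Real.sqrt_le_iff]
      refine ⟨by positivity, ?_⟩
      rw [mul_pow, Real.sq_sqrt (by positivity)]
      linarith
    have h10 : 0 < u ^ (1 / 2 - β) := by positivity
    rw [h8, inv_mul_eq_div, div_div, div_le_iff₀ (mul_pos (by linarith) (by positivity))]
    have h11 : 0 < √(u / 2) := by positivity
    have h12 : √u ≤ 4 * (1 - β) * √(u / 2) := by nlinarith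
    nlinarith [mul_le_mul_of_nonneg_left h12 h10.le]
  have e3 := mul_le_mul_of_nonneg_left (add_le_add e1 e2) hD
  linarith

/-- If `|f'| ≤ C |t|^γ`, then integrating from `0` gains one power. -/
lemma le_mul_abs_rpow_of_deriv {f f' : ℝ → ℝ} {C γ : ℝ} (hd : ∀ x, HasDerivAt f (f' x) x)
    (h0 : f 0 = 0) (hγ : 0 < γ) (hC : 0 ≤ C) (hf' : ∀ x, |f' x| ≤ C * |x| ^ γ) (r : ℝ) :
    |f r| ≤ C * |r| ^ (γ + 1) := by
  have h := Convex.norm_image_sub_le_of_norm_hasDerivWithin_le (f := f) (f' := f')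
    (s := uIcc 0 r) (x := 0) (y := r) (C := C * |r| ^ γ)
    (fun x _ => (hd x).hasDerivWithinAt) (fun x hx => ?_) (convex_uIcc 0 r) left_mem_uIcc
    right_mem_uIcc
  · rw [h0, sub_zero, sub_zero, Real.norm_eq_abs, Real.norm_eq_abs, mul_assoc] at h
    refine h.trans (le_of_eq ?_)
    rw [Real.rpow_add_one' (abs_nonneg r) (by linarith)]
  · refine (hf' x).trans ?_
    have hx' : |x| ≤ |r| := by simpa using abs_sub_left_of_mem_uIcc hx
    gcongr

lemma hasDerivAt_gfun {F F' : ℝ → ℝ} {A A' : ℝ} (hd : ∀ x, HasDerivAt F (F' x) x)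
    (hc' : Continuous F') (hF : CubicDecay F A) (hF' : CubicDecay F' A') (r : ℝ) :
    HasDerivAt (gfun F) (-(2 * π * √2) * halfPot F r) r := by
  have h := (hasDerivAt_integral_weight_mul cubicWeight_sqrt hd hc' hF hF' r).const_mul
    (4 * π * √2)
  rw [integral_sqrt_mul_deriv hd hc' hF hF' r] at h
  refine h.congr_deriv ?_
  rw [halfPot]
  ring

lemma condG_gfun {F F' : ℝ → ℝ} {A A' D β : ℝ} (hd : ∀ x, HasDerivAt F (F' x) x)
    (hc' : Continuous F') (hF : CubicDecay F A) (hF' : CubicDecay F' A')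
    (hpos : ∀ x, 0 < F x) (hβ : 0 < β) (hβ' : β < 1 / 2) (hD : 0 ≤ D)
    (hFD : ∀ x < 0, F x ≤ D * (-x) ^ (-β)) (h1 : gfun F 0 = 1)
    (hneg : ∀ r ≤ 0, halfPot F 0 ≤ halfPot F r) (hnn : ∀ r, 0 ≤ r → halfPot F r ≤ halfPot F 0) :
    CondG (gfun F) (3 / 2 - β) := by
  have hc : Continuous F := continuous_iff_continuousAt.2 fun x => (hd x).continuousAt
  have hg := hasDerivAt_gfun hd hc' hF hF'
  have hK : 0 < 2 * π * √2 := by positivity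
  have hderiv : deriv (gfun F) = fun r => -(2 * π * √2) * halfPot F r :=
    funext fun r => (hg r).deriv
  have hH : ∀ r, HasDerivAt (halfPot F) (halfPot F' r) r :=
    hasDerivAt_integral_weight_mul cubicWeight_inv_sqrt hd hc' hF hF'
  have hH' : Continuous (halfPot F') := continuous_integral_weight_mul cubicWeight_inv_sqrt hc' hF'
  set f : ℝ → ℝ := fun r => gfun F r - (gfun F 0 + deriv (gfun F) 0 * r) with hf
  have hfd : ∀ r, HasDerivAt f (deriv (gfun F) r - deriv (gfun F) 0) r := by
    intro r
    have := (hg r).sub (((hasDerivAt_id r).const_mul (deriv (gfun F) 0)).const_add (gfun F 0))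
    refine this.congr_deriv ?_
    simp [hderiv]
  have hf0 : f 0 = 0 := by simp [hf]
  have hfc : Continuous f := continuous_iff_continuousAt.2 fun x => (hfd x).continuousAt
  have hfdiff : Differentiable ℝ f := fun x => (hfd x).differentiableAt
  have hP0 := halfPot_pos hc hF hpos 0
  have hA := hF.nonneg
  set E : ℝ := 2 * π * √2 * (8 * D + 2 * A + halfPot F 0) with hE
  have hEpos : 0 < E := by positivity
  have hbound : ∀ r, |deriv (gfun F) r - deriv (gfun F) 0| ≤ E * |r| ^ (3 / 2 - β - 1) := by
    intro r
    have hexp : 3 / 2 - β - 1 = 1 / 2 - β := by ring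
    have hrw : deriv (gfun F) r - deriv (gfun F) 0 =
        2 * π * √2 * (halfPot F 0 - halfPot F r) := by
      rw [hderiv]; ring
    rw [hrw, abs_mul, abs_of_pos hK, hE, mul_assoc (2 * π * √2) (8 * D + _ + _), hexp]
    refine mul_le_mul_of_nonneg_left ?_ hK.le
    have hq : 0 ≤ |r| ^ (1 / 2 - β) := by positivity
    have hDq := mul_nonneg hD hq
    have hAq := mul_nonneg hA hq
    have hPq := mul_nonneg hP0.le hq
    rcases lt_or_ge r 0 with hr | hr
    · have h2 := halfPot_neg_sub_le hc hF (fun x => (hpos x).le) hβ hβ' hD hFD (neg_pos.2 hr)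
      rw [neg_neg] at h2
      rw [abs_of_nonpos (by linarith [hneg r hr.le])]
      rw [abs_of_neg hr] at *
      linarith
    · rw [abs_of_nonneg (by linarith [hnn r hr])]
      rw [abs_of_nonneg hr] at *
      rcases le_total r 1 with hr1 | hr1
      · have h2 := halfPot_sub_le_of_nonneg hc hF (fun x => (hpos x).le) hr
        have h3 : √r ≤ r ^ (1 / 2 - β) := by
          rcases hr.eq_or_lt with rfl | hr0
          · rw [Real.sqrt_zero]; exact hq
          · rw [Real.sqrt_eq_rpow]
            exact Real.rpow_le_rpow_of_exponent_ge hr0 hr1 (by linarith)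
        have h4 := mul_le_mul_of_nonneg_left h3 hA
        linarith
      · have h2 := halfPot_pos hc hF hpos r
        have h3 : 1 ≤ r ^ (1 / 2 - β) := Real.one_le_rpow hr1 (by linarith)
        have h4 := mul_le_mul_of_nonneg_left h3 hP0.le
        linarith
  refine ⟨h1, ?_, fun r => ?_, fun r => ?_, E, hEpos, E, hEpos, fun r => ⟨?_, hbound r⟩⟩
  · have h2 : (2 : WithTop ℕ∞) = 1 + 1 := by norm_num
    rw [h2, contDiff_succ_iff_deriv]
    refine ⟨fun r => (hg r).differentiableAt, by simp, ?_⟩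
    rw [hderiv, contDiff_one_iff_deriv]
    have h3 := fun r => (hH r).const_mul (-(2 * π * √2))
    refine ⟨fun r => (h3 r).differentiableAt, ?_⟩
    rw [funext fun r => (h3 r).deriv]
    exact continuous_const.mul hH'
  · rw [hderiv]
    have := mul_pos hK (halfPot_pos hc hF hpos r)
    simp only [neg_mul]
    linarith
  · have hfr : 0 ≤ f r := by
      rcases le_total r 0 with hr | hr
      · have hanti : AntitoneOn f (Iic 0) := by
          refine antitoneOn_of_deriv_nonpos (convex_Iic 0) hfc.continuousOn
            hfdiff.differentiableOn fun x hx => ?_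
          rw [interior_Iic] at hx
          rw [(hfd x).deriv, hderiv]
          nlinarith [hneg x (le_of_lt hx)]
        simpa [hf0] using hanti (mem_Iic.2 hr) (mem_Iic.2 le_rfl) hr
      · have hmono : MonotoneOn f (Ici 0) := by
          refine monotoneOn_of_deriv_nonneg (convex_Ici 0) hfc.continuousOn
            hfdiff.differentiableOn fun x hx => ?_
          rw [interior_Ici] at hx
          rw [(hfd x).deriv, hderiv]
          nlinarith [hnn x (le_of_lt hx)]
        simpa [hf0] using hmono (mem_Ici.2 le_rfl) (mem_Ici.2 hr) hr
    simp only [hf] at hfr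
    linarith
  · have := le_mul_abs_rpow_of_deriv hfd hf0 (by linarith) hEpos.le hbound r
    rw [sub_add_cancel] at this
    exact (le_abs_self _).trans this

/-- The formula for `Fbc` on the negative half-line, with `b = F0 0` and `a = F0' 0`. -/
def leftFun (a b β c r : ℝ) : ℝ :=
  c * r ^ 2 / (1 + r ^ 2) ^ ((β + 2) / 2) + Real.exp (-r ^ 2) * (b + a * r)

/-- The derivative of `leftFun`. -/
def leftDeriv (a b β c r : ℝ) : ℝ :=
  c * (2 * r - β * r ^ 3) / (1 + r ^ 2) ^ ((β + 2) / 2 + 1) +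
    Real.exp (-r ^ 2) * (a - 2 * b * r - 2 * a * r ^ 2)

lemma hasDerivAt_leftFun (a b β c r : ℝ) :
    HasDerivAt (leftFun a b β c) (leftDeriv a b β c r) r := by
  have hq : 0 < 1 + r ^ 2 := by positivity
  have h1 : HasDerivAt (fun x : ℝ => 1 + x ^ 2) (2 * r) r := by
    simpa using (hasDerivAt_pow 2 r).const_add 1
  have h2 := h1.rpow_const (p := (β + 2) / 2) (Or.inl hq.ne')
  have h3 : HasDerivAt (fun x : ℝ => c * x ^ 2) (c * (2 * r)) r := by
    simpa using (hasDerivAt_pow 2 r).const_mul c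
  have h4 : HasDerivAt (fun x : ℝ => Real.exp (-x ^ 2)) (Real.exp (-r ^ 2) * -(2 * r)) r := by
    have : HasDerivAt (fun x : ℝ => -x ^ 2) (-(2 * r)) r := by
      simpa using (hasDerivAt_pow 2 r).fun_neg
    exact this.exp
  have h5 : HasDerivAt (fun x : ℝ => b + a * x) a r := by
    simpa using ((hasDerivAt_id r).const_mul a).const_add b
  refine ((h3.div h2 (by positivity)).add (h4.mul h5)).congr_deriv ?_
  rw [leftDeriv, Real.rpow_sub_one hq.ne', Real.rpow_add_one hq.ne']
  have hp : 0 < (1 + r ^ 2) ^ ((β + 2) / 2) := by positivity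
  field_simp
  ring

lemma continuous_leftDeriv (a b β c : ℝ) : Continuous (leftDeriv a b β c) := by
  have h : Continuous fun r : ℝ => (1 + r ^ 2) ^ ((β + 2) / 2 + 1) :=
    Continuous.rpow_const (by fun_prop) fun r => Or.inl (by positivity)
  have h0 : ∀ r : ℝ, (1 + r ^ 2) ^ ((β + 2) / 2 + 1) ≠ 0 := fun r => by positivity
  unfold leftDeriv
  fun_prop (disch := exact h0 _)

lemma exp_neg_sq_mul_le (r : ℝ) : Real.exp (-r ^ 2) * (1 + r ^ 2) ≤ 1 := by
  rw [Real.exp_neg, inv_mul_le_one₀ (Real.exp_pos _)]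
  linarith [Real.add_one_le_exp (r ^ 2)]

lemma one_add_sq_le_rpow {r p : ℝ} (hp : 1 ≤ p) : 1 + r ^ 2 ≤ (1 + r ^ 2) ^ p := by
  calc 1 + r ^ 2 = (1 + r ^ 2) ^ (1:ℝ) := (Real.rpow_one _).symm
    _ ≤ _ := Real.rpow_le_rpow_of_exponent_le (by nlinarith [sq_nonneg r]) hp

lemma leftFun_pos {a b β c r : ℝ} (ha : a ≤ 0) (hb : 0 < b) (hc : 0 ≤ c) (hr : r ≤ 0) :
    0 < leftFun a b β c r := by
  have h1 : 0 < b + a * r := by nlinarith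
  unfold leftFun
  positivity

lemma leftFun_le {a b β c r : ℝ} (hβ : 0 < β) (ha : a ≤ 0) (hb : 0 < b) (hc : 0 ≤ c) :
    leftFun a b β c r ≤ c + (b - a) := by
  unfold leftFun
  have h1 := one_add_sq_le_rpow (r := r) (p := (β + 2) / 2) (by linarith)
  refine add_le_add ?_ ?_
  · rw [div_le_iff₀ (by positivity)]
    nlinarith
  · have h2 := exp_neg_sq_mul_le r
    have h3 : b + a * r ≤ (b - a) * (1 + r ^ 2) := by
      nlinarith [sq_nonneg (r + 1), mul_nonneg hb.le (sq_nonneg r),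
        mul_nonneg (neg_nonneg.2 ha) (sq_nonneg (r + 1)), mul_nonneg (neg_nonneg.2 ha) (sq_nonneg r)]
    calc Real.exp (-r ^ 2) * (b + a * r) ≤ Real.exp (-r ^ 2) * ((b - a) * (1 + r ^ 2)) := by gcongr
      _ = (b - a) * (Real.exp (-r ^ 2) * (1 + r ^ 2)) := by ring
      _ ≤ (b - a) * 1 := mul_le_mul_of_nonneg_left h2 (by linarith)
      _ = _ := mul_one _

lemma abs_leftDeriv_le {a b β c r : ℝ} (hβ : 0 < β) (hβ' : β < 1 / 2) (ha : a ≤ 0) (hb : 0 < b)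
    (hc : 0 ≤ c) : |leftDeriv a b β c r| ≤ 3 * c + 2 * (b - a) := by
  unfold leftDeriv
  refine (abs_add_le _ _).trans (add_le_add ?_ ?_)
  · have h1 : (1 + r ^ 2) ^ 2 ≤ (1 + r ^ 2) ^ ((β + 2) / 2 + 1) := by
      rw [← Real.rpow_natCast]
      exact Real.rpow_le_rpow_of_exponent_le (by nlinarith [sq_nonneg r]) (by norm_num; linarith)
    rw [abs_div, abs_mul, abs_of_nonneg hc,
      abs_of_pos (by positivity : 0 < (1 + r ^ 2) ^ ((β + 2) / 2 + 1)),
      div_le_iff₀ (by positivity)]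
    have h2 : |2 * r - β * r ^ 3| ≤ 3 * (1 + r ^ 2) ^ 2 := by
      have e1 : |2 * r - β * r ^ 3| = |r| * |2 - β * r ^ 2| := by rw [← abs_mul]; ring_nf
      have e2 : |2 - β * r ^ 2| ≤ 2 + r ^ 2 := by
        rw [abs_le]; constructor <;> nlinarith [sq_nonneg r]
      have e3 : |r| ≤ 1 + r ^ 2 := by
        rw [abs_le]; constructor <;> nlinarith [sq_nonneg (r + 1), sq_nonneg (r - 1)]
      rw [e1]
      have := mul_le_mul e3 e2 (abs_nonneg _) (by positivity)
      nlinarith [sq_nonneg r]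
    nlinarith [mul_le_mul_of_nonneg_left (h2.trans (mul_le_mul_of_nonneg_left h1 zero_le_three)) hc]
  · have h2 := exp_neg_sq_mul_le r
    have h3 : |a - 2 * b * r - 2 * a * r ^ 2| ≤ 2 * (b - a) * (1 + r ^ 2) := by
      rw [abs_le]
      constructor <;>
      nlinarith [mul_nonneg hb.le (sq_nonneg (r + 1)), mul_nonneg hb.le (sq_nonneg (r - 1)),
        mul_nonneg hb.le (sq_nonneg r), mul_nonneg (neg_nonneg.2 ha) (sq_nonneg r)]
    rw [abs_mul, abs_of_pos (Real.exp_pos _)]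
    calc Real.exp (-r ^ 2) * |a - 2 * b * r - 2 * a * r ^ 2|
        ≤ Real.exp (-r ^ 2) * (2 * (b - a) * (1 + r ^ 2)) := by gcongr
      _ = 2 * (b - a) * (Real.exp (-r ^ 2) * (1 + r ^ 2)) := by ring
      _ ≤ 2 * (b - a) * 1 := mul_le_mul_of_nonneg_left h2 (by linarith)
      _ = _ := mul_one _

lemma leftFun_le_rpow {a b β c r : ℝ} (hβ : 0 < β) (hβ' : β < 1 / 2) (ha : a ≤ 0) (hb : 0 < b)
    (hc : 0 ≤ c) (hr : r < 0) : leftFun a b β c r ≤ (c + 2 * (b - a)) * (-r) ^ (-β) := by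
  have hu : 0 < -r := neg_pos.2 hr
  have hpow : 0 < (-r) ^ β := by positivity
  unfold leftFun
  rw [add_mul]
  refine add_le_add ?_ ?_
  · rw [div_le_iff₀ (by positivity), mul_assoc]
    refine mul_le_mul_of_nonneg_left ?_ hc
    have h1 : (-r) ^ (β + 2) ≤ (1 + r ^ 2) ^ ((β + 2) / 2) := by
      have : (-r) ^ (β + 2) = (r ^ 2) ^ ((β + 2) / 2) := by
        rw [← neg_sq, ← Real.rpow_natCast, ← Real.rpow_mul hu.le]
        congr 1; push_cast; ring
      rw [this]
      exact Real.rpow_le_rpow (sq_nonneg r) (by linarith) (by linarith)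
    calc r ^ 2 = (-r) ^ (-β) * (-r) ^ (β + 2) := by
          rw [← Real.rpow_add hu]
          have : -β + (β + 2) = (2:ℕ) := by push_cast; ring
          rw [this, Real.rpow_natCast, neg_sq]
      _ ≤ _ := by gcongr
  · rw [Real.rpow_neg hu.le, ← div_eq_mul_inv, le_div_iff₀ hpow]
    have h2 := exp_neg_sq_mul_le r
    have h3 : (-r) ^ β ≤ 1 + -r := by
      rcases le_total (-r) 1 with h | h
      · linarith [Real.rpow_le_one hu.le h hβ.le]
      · have := Real.rpow_le_rpow_of_exponent_le h (by linarith : β ≤ 1)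
        rw [Real.rpow_one] at this
        linarith
    have h4 : (b + a * r) * (-r) ^ β ≤ 2 * (b - a) * (1 + r ^ 2) := by
      have h5 : b + a * r ≤ (b - a) * (1 + -r) := by nlinarith
      have h6 : 0 ≤ (b - a) * (1 + -r) := mul_nonneg (by linarith) (by linarith)
      have h7 := mul_le_mul h5 h3 hpow.le h6
      nlinarith [mul_nonneg (by linarith : 0 ≤ b - a) (sq_nonneg (r + 1))]
    calc Real.exp (-r ^ 2) * (b + a * r) * (-r) ^ β
        = Real.exp (-r ^ 2) * ((b + a * r) * (-r) ^ β) := by ring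
      _ ≤ Real.exp (-r ^ 2) * (2 * (b - a) * (1 + r ^ 2)) := by gcongr
      _ = 2 * (b - a) * (Real.exp (-r ^ 2) * (1 + r ^ 2)) := by ring
      _ ≤ 2 * (b - a) * 1 := mul_le_mul_of_nonneg_left h2 (by linarith)
      _ = _ := mul_one _

lemma leftDeriv_nonpos {a b β c r : ℝ} (hβ : 0 < β) (hβ' : β < 1 / 2) (ha : a ≤ 0) (hb : 0 < b)
    (hc : 16 * (b - a) ≤ c) (hr : r ≤ 0) (hr1 : -1 ≤ r) : leftDeriv a b β c r ≤ 0 := by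
  unfold leftDeriv
  have hsq : r ^ 2 ≤ 1 := by nlinarith
  have h1 : (1 + r ^ 2) ^ ((β + 2) / 2 + 1) ≤ 8 := by
    calc (1 + r ^ 2) ^ ((β + 2) / 2 + 1) ≤ (1 + r ^ 2) ^ ((3:ℕ):ℝ) :=
          Real.rpow_le_rpow_of_exponent_le (by nlinarith [sq_nonneg r]) (by push_cast; linarith)
      _ = (1 + r ^ 2) ^ 3 := Real.rpow_natCast _ _
      _ ≤ 2 ^ 3 := by gcongr; linarith
      _ = 8 := by norm_num
  have hc0 : 0 ≤ c := by linarith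
  have h2 : c * (2 * r - β * r ^ 3) / (1 + r ^ 2) ^ ((β + 2) / 2 + 1) ≤ c * r / 8 := by
    rw [div_le_div_iff₀ (by positivity) (by norm_num)]
    have h3 : 2 * r - β * r ^ 3 ≤ r := by nlinarith [mul_nonneg hβ.le (sq_nonneg r)]
    have h4 : c * r ≤ 0 := mul_nonpos_of_nonneg_of_nonpos hc0 hr
    nlinarith [mul_le_mul_of_nonneg_left h3 hc0]
  have h5 : a - 2 * b * r - 2 * a * r ^ 2 ≤ 2 * (b - a) * (-r) := by
    nlinarith [mul_nonneg (neg_nonneg.2 ha) (mul_nonneg (neg_nonneg.2 hr) (by linarith : 0 ≤ 1 + r))]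
  have h6 : Real.exp (-r ^ 2) ≤ 1 := Real.exp_le_one_iff.2 (by nlinarith [sq_nonneg r])
  have h7 : 0 ≤ 2 * (b - a) * (-r) := mul_nonneg (by linarith) (by linarith)
  have h8 := mul_le_mul_of_nonneg_left h5 (Real.exp_pos (-r ^ 2)).le
  nlinarith [mul_le_mul_of_nonneg_right h6 h7]

lemma le_leftFun {a b β c r u : ℝ} (hβ : 0 < β) (hβ' : β < 1 / 2) (ha : a ≤ 0) (hb : 0 < b)
    (hc : 0 ≤ c) (hu : 1 ≤ u) (hr : r ≤ -(u / 2)) (hr' : -u ≤ r) :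
    c / 16 * (√u)⁻¹ ≤ leftFun a b β c r := by
  have h0 : 0 ≤ Real.exp (-r ^ 2) * (b + a * r) :=
    mul_nonneg (Real.exp_pos _).le (by nlinarith)
  have h1 : (1 + r ^ 2) ^ ((β + 2) / 2) ≤ 4 * (u ^ 2 * √u) := by
    calc (1 + r ^ 2) ^ ((β + 2) / 2) ≤ (2 * u ^ 2) ^ ((β + 2) / 2) :=
          Real.rpow_le_rpow (by positivity) (by nlinarith) (by linarith)
      _ ≤ (2 * u ^ 2) ^ (5 / 4 : ℝ) :=
          Real.rpow_le_rpow_of_exponent_le (by nlinarith) (by linarith)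
      _ = 2 ^ (5 / 4 : ℝ) * (u ^ 2 * √u) := by
          rw [Real.mul_rpow (by norm_num) (by positivity), ← Real.rpow_natCast u 2,
            ← Real.rpow_mul (by linarith), Real.sqrt_eq_rpow, ← Real.rpow_add (by linarith)]
          norm_num
      _ ≤ 2 ^ (2 : ℝ) * (u ^ 2 * √u) := by
          gcongr
          · norm_num
          · norm_num
      _ = _ := by norm_num
  have hsu : 0 < √u := Real.sqrt_pos.2 (by linarith)
  have h2 : c / 16 * (√u)⁻¹ ≤ c * r ^ 2 / (1 + r ^ 2) ^ ((β + 2) / 2) := by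
    rw [le_div_iff₀ (by positivity)]
    have h3 : u ^ 2 / 4 ≤ r ^ 2 := by nlinarith
    calc c / 16 * (√u)⁻¹ * (1 + r ^ 2) ^ ((β + 2) / 2)
        ≤ c / 16 * (√u)⁻¹ * (4 * (u ^ 2 * √u)) := by gcongr
      _ = c * (u ^ 2 / 4) := by field_simp; norm_num
      _ ≤ c * r ^ 2 := by gcongr
  unfold leftFun
  linarith

lemma half_le_halfPot {F : ℝ → ℝ} {A m u : ℝ} (hc : Continuous F) (hF : CubicDecay F A)
    (hpos : ∀ x, 0 ≤ F x) (hu : 0 < u) (hm : 0 ≤ m)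
    (h : ∀ x, -u ≤ x → x ≤ -(u / 2) → m * (√u)⁻¹ ≤ F x) : m / 2 ≤ halfPot F (-u) := by
  have hi := integrableOn_weight_mul cubicWeight_inv_sqrt hc hF (-u)
  have h1 : ∫ s in Ioc 0 (u / 2), (√s)⁻¹ * F (-u + s) ≤ halfPot F (-u) := by
    refine setIntegral_mono_set hi (Filter.Eventually.of_forall fun s => ?_)
      (LE.le.eventuallyLE Ioc_subset_Ioi_self)
    exact mul_nonneg (by positivity) (hpos _)
  have h2 : ∫ _ in Ioc 0 (u / 2), m * u⁻¹ ≤ ∫ s in Ioc 0 (u / 2), (√s)⁻¹ * F (-u + s) := by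
    refine setIntegral_mono_on (integrableOn_const (by simp)) (hi.mono_set Ioc_subset_Ioi_self)
      measurableSet_Ioc fun s hs => ?_
    have hs0 : 0 < s := hs.1
    have hs1 : s ≤ u / 2 := hs.2
    have h3 := h (-u + s) (by linarith) (by linarith)
    have h4 : (√u)⁻¹ ≤ (√s)⁻¹ := by
      gcongr
      linarith
    calc m * u⁻¹ = (√u)⁻¹ * (m * (√u)⁻¹) := by
          nth_rewrite 1 [← Real.mul_self_sqrt hu.le]
          rw [mul_inv]
          ring
      _ ≤ (√s)⁻¹ * F (-u + s) := mul_le_mul h4 h3 (by positivity) (by positivity)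
  have h5 : ∫ _ in Ioc 0 (u / 2), m * u⁻¹ = m / 2 := by
    rw [setIntegral_const, Measure.real, Real.volume_Ioc, sub_zero,
      ENNReal.toReal_ofReal (by positivity), smul_eq_mul]
    field_simp
  linarith

/-- The derivative of `Fbc`. -/
def FbcDeriv (F0 F0' : ℝ → ℝ) (β c r : ℝ) : ℝ :=
  F0' (max r 0) + leftDeriv (F0' 0) (F0 0) β c (min r 0) - F0' 0

section Extension

variable {F0 F0' : ℝ → ℝ} {β c r : ℝ}

lemma Fbc_of_nonneg (hr : 0 ≤ r) : Fbc F0 F0' β c r = F0 r := if_pos hr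

lemma Fbc_of_nonpos (hr : r ≤ 0) : Fbc F0 F0' β c r = leftFun (F0' 0) (F0 0) β c r := by
  rcases hr.eq_or_lt with rfl | hr
  · simp [Fbc, leftFun]
  · exact if_neg (not_le.2 hr)

lemma FbcDeriv_of_nonneg (hr : 0 ≤ r) : FbcDeriv F0 F0' β c r = F0' r := by
  simp [FbcDeriv, hr, leftDeriv]

lemma FbcDeriv_of_nonpos (hr : r ≤ 0) :
    FbcDeriv F0 F0' β c r = leftDeriv (F0' 0) (F0 0) β c r := by
  simp [FbcDeriv, hr]

lemma hasDerivAt_Fbc (hd : ∀ r, 0 ≤ r → HasDerivWithinAt F0 (F0' r) (Ici 0) r) (r : ℝ) :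
    HasDerivAt (Fbc F0 F0' β c) (FbcDeriv F0 F0' β c r) r := by
  have hright : 0 ≤ r → HasDerivWithinAt (Fbc F0 F0' β c) (FbcDeriv F0 F0' β c r) (Ici 0) r := by
    intro hr
    rw [FbcDeriv_of_nonneg hr]
    exact (hd r hr).congr (fun x hx => Fbc_of_nonneg hx) (Fbc_of_nonneg hr)
  have hleft : r ≤ 0 → HasDerivWithinAt (Fbc F0 F0' β c) (FbcDeriv F0 F0' β c r) (Iic 0) r := by
    intro hr
    rw [FbcDeriv_of_nonpos hr]
    exact (hasDerivAt_leftFun _ _ _ _ r).hasDerivWithinAt.congr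
      (fun x hx => Fbc_of_nonpos hx) (Fbc_of_nonpos hr)
  rcases lt_trichotomy r 0 with hr | rfl | hr
  · exact (hleft hr.le).hasDerivAt (Iic_mem_nhds hr)
  · have h := (hright le_rfl).union (hleft le_rfl)
    rwa [union_comm, Iic_union_Ici, hasDerivWithinAt_univ] at h
  · exact (hright hr.le).hasDerivAt (Ici_mem_nhds hr)

lemma continuous_FbcDeriv (hc' : ContinuousOn F0' (Ici 0)) : Continuous (FbcDeriv F0 F0' β c) := by
  have h1 : Continuous fun r : ℝ => F0' (max r 0) :=
    hc'.comp_continuous (by fun_prop) fun r => le_max_right r 0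
  have h2 : Continuous fun r : ℝ => leftDeriv (F0' 0) (F0 0) β c (min r 0) :=
    (continuous_leftDeriv _ _ _ _).comp (by fun_prop)
  exact (h1.add h2).sub continuous_const

lemma AssumptionA.pos (h : AssumptionA F0 F0') (hr : 0 ≤ r) : 0 < F0 r := by
  obtain ⟨hnn, hd, -, -, -, hneg⟩ := h
  have hanti : StrictAntiOn F0 (Ici 0) := by
    refine strictAntiOn_of_deriv_neg (convex_Ici 0)
      (fun x hx => (hd x hx).continuousWithinAt) fun x hx => ?_
    rw [interior_Ici] at hx
    rw [((hd x (le_of_lt hx)).hasDerivAt (Ici_mem_nhds hx)).deriv]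
    exact hneg x (le_of_lt hx)
  have h1 : 0 ≤ r + 1 := by linarith
  exact (hnn (r + 1) h1).trans_lt (hanti (mem_Ici.2 hr) (mem_Ici.2 h1) (lt_add_one r))

lemma Fbc_pos (h : AssumptionA F0 F0') (hc : 0 ≤ c) (r : ℝ) : 0 < Fbc F0 F0' β c r := by
  rcases le_total 0 r with hr | hr
  · rw [Fbc_of_nonneg hr]
    exact h.pos hr
  · rw [Fbc_of_nonpos hr]
    exact leftFun_pos (h.2.2.2.2.2 0 le_rfl).le (h.pos le_rfl) hc hr

end Extension

lemma cubicDecay_of_nonneg_of_nonpos {f : ℝ → ℝ} {C M : ℝ} (hC : 0 ≤ C) (hM : 0 ≤ M)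
    (h1 : ∀ x, 0 ≤ x → |f x| ≤ C / (1 + x ^ 3)) (h2 : ∀ x ≤ 0, |f x| ≤ M) :
    CubicDecay f (4 * C + M) := by
  intro x
  rcases le_total 0 x with hx | hx
  · rw [max_eq_left hx]
    refine (h1 x hx).trans ?_
    rw [div_le_div_iff₀ (by positivity) (by positivity)]
    have h3 : (1 + x) ^ 3 ≤ 4 * (1 + x ^ 3) := by
      nlinarith [mul_nonneg (by linarith : 0 ≤ 1 + x) (sq_nonneg (x - 1))]
    have h4 : 0 ≤ M * (1 + x ^ 3) := by positivity
    nlinarith [mul_le_mul_of_nonneg_left h3 hC]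
  · rw [max_eq_right hx]
    simp only [add_zero, one_pow, div_one]
    linarith [h2 x hx]

/-- Lemma 2.1: for β ∈ (0,1/2) and all sufficiently large c > 0, the extension
F_{β,c} lies in C¹_b(ℝ;[0,∞)) and its g_{β,c} satisfies Conditions (G) with
exponent α = 3/2 − β. -/
theorem Fbc_extension_satisfies_conditions
    (F0 F0' : ℝ → ℝ) (β : ℝ)
    (hF0 : AssumptionA F0 F0') (hβ : 0 < β) (hβ' : β < 1 / 2) :
    ∃ c₀ : ℝ, 0 < c₀ ∧ ∀ c : ℝ, c₀ ≤ c →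
      C1b (Fbc F0 F0' β c) ∧
      (∀ r : ℝ, 0 ≤ Fbc F0 F0' β c r) ∧
      CondG (gfun (Fbc F0 F0' β c)) (3 / 2 - β) := by
  obtain ⟨-, hd, hc', hnorm, ⟨C, hC, hdec⟩, hneg⟩ := id hF0
  have ha : F0' 0 ≤ 0 := (hneg 0 le_rfl).le
  have hb : 0 < F0 0 := hF0.pos le_rfl
  refine ⟨1 + 16 * (F0 0 - F0' 0) + 32 * |∫ s in Ioi (0:ℝ), (√s)⁻¹ * F0 s|,
    by have := abs_nonneg (∫ s in Ioi (0:ℝ), (√s)⁻¹ * F0 s); linarith, fun c hc => ?_⟩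
  have hI := abs_nonneg (∫ s in Ioi (0:ℝ), (√s)⁻¹ * F0 s)
  have hc0 : 0 ≤ c := by linarith
  have hpos := Fbc_pos (β := β) hF0 hc0
  have hFd := hasDerivAt_Fbc (β := β) (c := c) hd
  have hFc' := continuous_FbcDeriv (F0 := F0) (β := β) (c := c) hc'
  have hFc : Continuous (Fbc F0 F0' β c) :=
    continuous_iff_continuousAt.2 fun x => (hFd x).continuousAt
  have hF : CubicDecay (Fbc F0 F0' β c) (4 * C + (c + (F0 0 - F0' 0))) := by
    refine cubicDecay_of_nonneg_of_nonpos hC.le (by linarith) (fun x hx => ?_) fun x hx => ?_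
    · rw [Fbc_of_nonneg hx]
      linarith [hdec x hx, abs_nonneg (F0' x)]
    · rw [abs_of_pos (hpos x), Fbc_of_nonpos hx]
      exact leftFun_le hβ ha hb hc0
  have hF' : CubicDecay (FbcDeriv F0 F0' β c) (4 * C + (3 * c + 2 * (F0 0 - F0' 0))) := by
    refine cubicDecay_of_nonneg_of_nonpos hC.le (by linarith) (fun x hx => ?_) fun x hx => ?_
    · rw [FbcDeriv_of_nonneg hx]
      linarith [hdec x hx, abs_nonneg (F0 x)]
    · rw [FbcDeriv_of_nonpos hx]
      exact abs_leftDeriv_le hβ hβ' ha hb hc0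
  have hderiv : deriv (Fbc F0 F0' β c) = FbcDeriv F0 F0' β c := funext fun r => (hFd r).deriv
  have hanti : AntitoneOn (Fbc F0 F0' β c) (Ici (-1)) := by
    refine antitoneOn_of_deriv_nonpos (convex_Ici _) hFc.continuousOn
      (fun x _ => (hFd x).differentiableAt.differentiableWithinAt) fun x hx => ?_
    rw [interior_Ici] at hx
    rw [hderiv]
    rcases le_total 0 x with h | h
    · rw [FbcDeriv_of_nonneg h]
      exact (hneg x h).le
    · rw [FbcDeriv_of_nonpos h]
      exact leftDeriv_nonpos hβ hβ' ha hb (by linarith) h (le_of_lt hx)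
  have hpot0 : halfPot (Fbc F0 F0' β c) 0 = ∫ s in Ioi (0:ℝ), (√s)⁻¹ * F0 s := by
    refine setIntegral_congr_fun measurableSet_Ioi fun s hs => ?_
    simp only [zero_add]
    rw [Fbc_of_nonneg (le_of_lt hs)]
  refine ⟨⟨?_, ?_⟩, fun r => (hpos r).le, ?_⟩
  · rw [contDiff_one_iff_deriv, hderiv]
    exact ⟨fun r => (hFd r).differentiableAt, hFc'⟩
  · rw [hderiv]
    exact ⟨_, fun r => ⟨(hF.abs_le r).trans (le_max_left _ _),
      (hF'.abs_le r).trans (le_max_right _ _)⟩⟩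
  · refine condG_gfun hFd hFc' hF hF' hpos hβ hβ' (D := c + 2 * (F0 0 - F0' 0)) (by linarith)
      (fun x hx => ?_) ?_ (fun r hr => ?_) fun r hr => ?_
    · rw [Fbc_of_nonpos hx.le]
      exact leftFun_le_rpow hβ hβ' ha hb hc0 hx
    · rw [gfun, ← hnorm]
      congr 1
      refine setIntegral_congr_fun measurableSet_Ioi fun s hs => ?_
      simp only [zero_add]
      rw [Fbc_of_nonneg (le_of_lt hs)]
    · rcases le_total (-1) r with h | h
      · refine halfPot_mono hFc hF fun s hs => ?_
        exact hanti (mem_Ici.2 (by linarith)) (mem_Ici.2 (by linarith)) (by linarith)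
      · have h1 := half_le_halfPot hFc hF (fun x => (hpos x).le) (u := -r) (m := c / 16)
          (by linarith) (by positivity) fun x hx hx' => by
            rw [Fbc_of_nonpos (by linarith)]
            exact le_leftFun hβ hβ' ha hb hc0 (by linarith) hx' hx
        rw [neg_neg] at h1
        rw [hpot0]
        linarith [le_abs_self (∫ s in Ioi (0:ℝ), (√s)⁻¹ * F0 s)]
    · refine halfPot_mono hFc hF fun s hs => ?_
      exact hanti (mem_Ici.2 (by linarith)) (mem_Ici.2 (by linarith)) (by linarith)

end
end

section
/- Let β ∈ (0, 1/2) and c' > 0. Then there exists a constant c(c') > 0 such that for every r ≤ −c': ∫₀^{|r|} √s (r+s)² / (1+(r+s)²)^{(β+2)/2} ds ≥ c(c') |r|^{3/2−β}. -/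
open MeasureTheory Real Set

/-- Step 4 of Lemma 2.1 (lower bound): for β ∈ (0,1/2) and c' > 0 there is a
constant c(c') > 0 such that for every r ≤ −c',
∫₀^{|r|} √s (r+s)²/(1+(r+s)²)^{(β+2)/2} ds ≥ c(c') |r|^{3/2−β}. -/
theorem integral_lower_bound
    (β c' : ℝ) (hβ : 0 < β) (hβ' : β < 1 / 2) (hc' : 0 < c') :
    ∃ c : ℝ, 0 < c ∧ ∀ r : ℝ, r ≤ -c' →
      c * |r| ^ (3 / 2 - β) ≤
        ∫ s in Ioo (0 : ℝ) |r|,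
          Real.sqrt s * (r + s) ^ 2 / (1 + (r + s) ^ 2) ^ ((β + 2) / 2) := by
  set K : ℝ := 1 + 1 / c' ^ 2 with hK
  have hKpos : 0 < K := by positivity
  refine ⟨1 / (32 * K ^ ((β + 2) / 2)), by positivity, fun r hr => ?_⟩
  obtain ⟨R, rfl⟩ : ∃ R, r = -R := ⟨-r, by ring⟩
  have hRc : c' ≤ R := by linarith
  have hR : 0 < R := hc'.trans_le hRc
  rw [abs_neg, abs_of_pos hR]
  set f : ℝ → ℝ := fun s =>
    Real.sqrt s * (-R + s) ^ 2 / (1 + (-R + s) ^ 2) ^ ((β + 2) / 2) with hf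
  have hcont : Continuous f := by
    refine Continuous.div (by fun_prop) ?_ fun s => by positivity
    exact Continuous.rpow_const (by fun_prop) fun s => Or.inl (by positivity)
  have hint : IntegrableOn f (Ioo 0 R) :=
    (hcont.integrableOn_Icc (a := 0) (b := R)).mono_set Ioo_subset_Icc_self
  have hsub : Ioo (R / 4) (R / 2) ⊆ Ioo 0 R := Ioo_subset_Ioo (by linarith) (by linarith)
  have hmono : ∫ s in Ioo (R / 4) (R / 2), f s ≤ ∫ s in Ioo 0 R, f s :=
    setIntegral_mono_set hint (Filter.Eventually.of_forall fun s => by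
      simp only [hf, Pi.zero_apply]; positivity) hsub.eventuallyLE
  have hbound : ∀ s ∈ Ioo (R / 4) (R / 2),
      √R / 2 * (R ^ 2 / 4) / (K * R ^ 2) ^ ((β + 2) / 2) ≤ f s := by
    intro s hs
    have hsqrt : √R / 2 ≤ √s := by
      apply Real.le_sqrt_of_sq_le
      rw [div_pow, Real.sq_sqrt hR.le]
      linarith [hs.1]
    have hsq : R ^ 2 / 4 ≤ (-R + s) ^ 2 := by nlinarith [hs.1, hs.2]
    have hden : 1 + (-R + s) ^ 2 ≤ K * R ^ 2 := by
      have h1 : 1 ≤ 1 / c' ^ 2 * R ^ 2 := by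
        rw [one_div_mul_eq_div, one_le_div (by positivity)]
        gcongr
      have h2 : (-R + s) ^ 2 ≤ R ^ 2 := by nlinarith [hs.1, hs.2]
      rw [hK]
      linarith
    simp only [hf]
    gcongr
  have hconst := setIntegral_ge_of_const_le_real measurableSet_Ioo (by simp) hbound
    (hint.mono_set hsub)
  refine le_trans (le_of_eq ?_) (hconst.trans hmono)
  rw [Real.volume_real_Ioo_of_le (by linarith), Real.mul_rpow hKpos.le (by positivity),
    ← Real.rpow_natCast R 2, ← Real.rpow_mul hR.le, Real.sqrt_eq_rpow]
  have hexp : R ^ (3 / 2 - β) * R ^ (((2 : ℕ) : ℝ) * ((β + 2) / 2)) =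
      R ^ (1 / 2 : ℝ) * R ^ ((2 : ℕ) : ℝ) * R := by
    nth_rewrite 5 [← Real.rpow_one R]
    simp only [← Real.rpow_add hR]
    congr 1
    push_cast
    ring
  have hpos : 0 < R ^ (((2 : ℕ) : ℝ) * ((β + 2) / 2)) := by positivity
  rw [← eq_div_iff hpos.ne'] at hexp
  rw [hexp]
  field_simp
  ring
end

section
/- Let F0 satisfy Assumption (A), let 0 < β₁ < β₂ < 1/2 and c > 0, and let F₁ = F_{β₁,c}, F₂ = F_{β₂,c}. Then for every y < 0: inf_{r ∈ ℝ} ∫_{ℝ³} |F₁(½|v|² + y) − F₂(½|v|² + r)| dv > 0. Consequently, if Q₁, Q₂ : ℝ³ → ℝ are measurable and Q₁ < 0 on a set A of positive Lebesgue measure, then the functions f₁(x,v) = F₁(½|v|² + Q₁(x)) and f₂(x,v) = F₂(½|v|² + Q₂(x)) satisfy ∫_{ℝ³×ℝ³} |f₁ − f₂| dx dv > 0, i.e. f₁ ≠ f₂ as elements of L¹_loc. -/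
open MeasureTheory Real Set

noncomputable section

open Filter Topology

namespace AssumptionA

variable {F0 F0' : ℝ → ℝ}

theorem continuousOn (hF0 : AssumptionA F0 F0') : ContinuousOn F0 (Ici 0) :=
  fun r hr => (hF0.2.1 r hr).continuousWithinAt

theorem strictAntiOn (hF0 : AssumptionA F0 F0') : StrictAntiOn F0 (Ici 0) := by
  refine strictAntiOn_of_deriv_neg (convex_Ici 0) hF0.continuousOn fun r hr => ?_
  rw [interior_Ici, mem_Ioi] at hr
  rw [((hF0.2.1 r hr.le).hasDerivAt (Ici_mem_nhds hr)).deriv]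
  exact hF0.2.2.2.2.2 r hr.le

theorem pos_s19 (hF0 : AssumptionA F0 F0') {r : ℝ} (hr : 0 ≤ r) : 0 < F0 r :=
  (hF0.1 (r + 1) (by linarith)).trans_lt
    (hF0.strictAntiOn hr (show (0 : ℝ) ≤ r + 1 by linarith) (by linarith))

theorem exists_bound (hF0 : AssumptionA F0 F0') :
    ∃ C : ℝ, 0 < C ∧ ∀ r, 0 ≤ r → |F0 r| ≤ C / (1 + r ^ 3) := by
  obtain ⟨C, hC, h⟩ := hF0.2.2.2.2.1
  exact ⟨C, hC, fun r hr => (le_add_of_nonneg_right (abs_nonneg _)).trans (h r hr)⟩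

theorem Fbc_continuous (hF0 : AssumptionA F0 F0') (β c : ℝ) : Continuous (Fbc F0 F0' β c) := by
  unfold Fbc
  refine continuous_if_le continuous_const continuous_id hF0.continuousOn
    (Continuous.continuousOn ?_) ?_
  · refine Continuous.add (Continuous.div (by fun_prop) ?_ fun r => ?_) (by fun_prop)
    · exact Continuous.rpow_const (by fun_prop) fun r => Or.inl (by positivity)
    · positivity
  · rintro r rfl
    simp

theorem Fbc_pos (hF0 : AssumptionA F0 F0') {β c : ℝ} (hc : 0 < c) (r : ℝ) :
    0 < Fbc F0 F0' β c r := by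
  unfold Fbc
  split_ifs with hr
  · exact hF0.pos_s19 hr
  · have hpos := hF0.pos_s19 le_rfl
    have hmul := mul_pos_of_neg_of_neg (hF0.2.2.2.2.2 0 le_rfl) (not_le.1 hr)
    positivity

theorem tendsto_Fbc_cocompact (hF0 : AssumptionA F0 F0') {β : ℝ} (hβ : 0 < β) {c : ℝ}
    (hc : 0 < c) : Tendsto (Fbc F0 F0' β c) (cocompact ℝ) (𝓝 0) := by
  rw [cocompact_eq_atBot_atTop]
  refine Tendsto.sup ?_ ?_
  · have hsq : Tendsto (fun r : ℝ => 1 + r ^ 2) atBot atTop :=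
      tendsto_atTop_add_const_left _ _ (by
      simpa [Function.comp_def] using
        (tendsto_pow_atTop (α := ℝ) two_ne_zero).comp tendsto_neg_atBot_atTop)
    have hpow : Tendsto (fun r : ℝ => c * (1 + r ^ 2) ^ (-(β / 2))) atBot (𝓝 0) := by
      simpa using ((tendsto_rpow_neg_atTop (half_pos hβ)).comp hsq).const_mul c
    have hfrac : Tendsto (fun r : ℝ => c * r ^ 2 / (1 + r ^ 2) ^ ((β + 2) / 2)) atBot (𝓝 0) := by
      refine squeeze_zero (fun r => by positivity) (fun r => ?_) hpow
      have h : (0 : ℝ) < 1 + r ^ 2 := by positivity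
      rw [div_le_iff₀ (by positivity), mul_assoc, ← Real.rpow_add h]
      rw [show -(β / 2) + (β + 2) / 2 = 1 by ring, Real.rpow_one]
      nlinarith
    have hgauss (s : ℝ) : Tendsto (fun r : ℝ => |r| ^ s * Real.exp (-1 * r ^ 2)) atBot (𝓝 0) :=
      (tendsto_rpow_abs_mul_exp_neg_mul_sq_cocompact one_pos s).mono_left atBot_le_cocompact
    have hsum := hfrac.add (((hgauss 0).const_mul (F0 0)).sub ((hgauss 1).const_mul (F0' 0)))
    simp only [mul_zero, sub_zero, add_zero] at hsum
    refine hsum.congr' ?_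
    filter_upwards [eventually_lt_atBot 0] with r hr
    simp only [Fbc, if_neg hr.not_ge, Real.rpow_zero, Real.rpow_one, abs_of_neg hr]
    ring_nf
  · obtain ⟨C, hC, hb⟩ := hF0.exists_bound
    refine squeeze_zero_norm' (a := fun r => C / (1 + r ^ 3)) ?_ ?_
    · filter_upwards [eventually_ge_atTop 0] with r hr
      simpa [Fbc, hr] using hb r hr
    · exact (tendsto_atTop_add_const_left _ _ (tendsto_pow_atTop three_ne_zero)).const_div_atTop C

theorem Fbc_bounded (hF0 : AssumptionA F0 F0') {β : ℝ} (hβ : 0 < β) {c : ℝ} (hc : 0 < c) :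
    ∃ M, ∀ r, |Fbc F0 F0' β c r| ≤ M :=
  let f : ZeroAtInftyContinuousMap ℝ ℝ :=
    ⟨⟨Fbc F0 F0' β c, hF0.Fbc_continuous β c⟩, hF0.tendsto_Fbc_cocompact hβ hc⟩
  ⟨‖f.toBCF‖, f.toBCF.norm_coe_le_norm⟩

theorem integrable_Fbc_kinetic (hF0 : AssumptionA F0 F0') (β c a : ℝ) :
    Integrable fun v : R3 => Fbc F0 F0' β c (‖v‖ ^ 2 / 2 + a) := by
  have hcont : Continuous fun v : R3 => Fbc F0 F0' β c (‖v‖ ^ 2 / 2 + a) :=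
    (hF0.Fbc_continuous β c).comp (by fun_prop)
  have hint : Integrable fun v : R3 => (1 + ‖v‖ ^ 2) ^ (-(4 : ℝ) / 2) :=
    integrable_rpow_neg_one_add_norm_sq (by simp; norm_num)
  refine hcont.locallyIntegrable.integrable_of_isBigO_cocompact ?_ (hint.integrableAtFilter _)
  obtain ⟨C, hC, hb⟩ := hF0.exists_bound
  refine Asymptotics.IsBigO.of_bound (256 * C) ?_
  have hlarge := ((tendsto_pow_atTop two_ne_zero).comp
    (tendsto_norm_cocompact_atTop (E := R3))).eventually_ge_atTop (4 * |a| + 1)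
  filter_upwards [hlarge] with v hv
  simp only [Function.comp_apply] at hv
  set s := ‖v‖ ^ 2
  have ha := neg_abs_le a
  have hs : 1 ≤ s := by linarith [abs_nonneg a]
  have ht : s / 4 ≤ s / 2 + a := by linarith
  have ht0 : 0 ≤ s / 2 + a := by linarith
  rw [show (-(4 : ℝ) / 2) = ((-2 : ℤ) : ℝ) by norm_num, Real.rpow_intCast]
  simp only [Fbc, if_pos ht0, Real.norm_eq_abs]
  rw [abs_of_pos (show 0 < (1 + s) ^ (-2 : ℤ) by positivity), zpow_neg, ← div_eq_mul_inv]
  refine (hb _ ht0).trans ?_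
  have hcube : (s / 4) ^ 3 ≤ (s / 2 + a) ^ 3 := pow_le_pow_left₀ (by positivity) ht 3
  refine (div_le_div_of_nonneg_left hC.le (by positivity)
    (show 1 + (s / 4) ^ 3 ≤ _ by linarith)).trans ?_
  norm_cast
  rw [div_le_div_iff₀ (by positivity) (by positivity), mul_comm 256 C, mul_assoc]
  refine mul_le_mul_of_nonneg_left ?_ hC.le
  nlinarith [mul_nonneg (sq_nonneg s) (sub_nonneg.2 hs)]

theorem exists_Fbc_kinetic_ne (hF0 : AssumptionA F0 F0') {β₁ β₂ c y : ℝ} (h12 : β₁ < β₂)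
    (hc : 0 < c) (hy : y < 0) (r : ℝ) :
    ∃ v : R3, Fbc F0 F0' β₁ c (‖v‖ ^ 2 / 2 + y) ≠ Fbc F0 F0' β₂ c (‖v‖ ^ 2 / 2 + r) := by
  by_cases hr : r = y
  · subst hr
    refine ⟨0, ne_of_gt ?_⟩
    simp only [norm_zero, ne_eq, OfNat.ofNat_ne_zero, not_false_eq_true, zero_pow, zero_div,
      zero_add, Fbc, if_neg hy.not_ge]
    have hsq : 0 < r ^ 2 := sq_pos_of_neg hy
    have hpow : (1 + r ^ 2) ^ ((β₁ + 2) / 2) < (1 + r ^ 2) ^ ((β₂ + 2) / 2) :=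
      Real.rpow_lt_rpow_of_exponent_lt (by linarith) (by linarith)
    gcongr
  · obtain ⟨v, hv⟩ := exists_norm_eq R3 (Real.sqrt_nonneg (2 * (|y| + |r|)))
    have hv2 : ‖v‖ ^ 2 / 2 = |y| + |r| := by
      rw [hv, Real.sq_sqrt (by positivity)]
      ring
    have hy0 : 0 ≤ |y| + |r| + y := by linarith [neg_abs_le y, abs_nonneg r]
    have hr0 : 0 ≤ |y| + |r| + r := by linarith [neg_abs_le r, abs_nonneg y]
    refine ⟨v, fun h => hr ?_⟩
    rw [hv2, Fbc, Fbc, if_pos hy0, if_pos hr0] at h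
    linarith [hF0.strictAntiOn.injOn hy0 hr0 h]

end AssumptionA

theorem exists_pos_forall_le_of_tendsto_cocompact {J : ℝ → ℝ} (hJ : Continuous J)
    (hpos : ∀ r, 0 < J r) {L : ℝ} (hL : 0 < L) (hlim : Tendsto J (cocompact ℝ) (𝓝 L)) :
    ∃ m, 0 < m ∧ ∀ r, m ≤ J r := by
  by_cases h : ∃ r₀, J r₀ < L
  · obtain ⟨r₀, hr₀⟩ := h
    obtain ⟨x, hx⟩ := hJ.exists_forall_le' r₀
      ((hlim.eventually (lt_mem_nhds hr₀)).mono fun _ => le_of_lt)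
    exact ⟨J x, hpos x, hx⟩
  · exact ⟨L, hL, fun r => not_lt.1 fun hr => h ⟨r, hr⟩⟩

/-- A Gaussian-weighted lower bound for the `L¹` distance, uniform in the translation `r`:
the weight makes dominated convergence available for all `r` at once. -/
theorem exists_pos_le_integral_abs_sub {F G : ℝ → ℝ} (hF : Continuous F) (hG : Continuous G)
    (hFpos : ∀ t, 0 < F t) {M N : ℝ} (hM : ∀ t, |F t| ≤ M) (hN : ∀ t, |G t| ≤ N)
    (hG0 : Tendsto G (cocompact ℝ) (𝓝 0)) (y : ℝ)
    (hFi : Integrable fun v : R3 => F (‖v‖ ^ 2 / 2 + y))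
    (hGi : ∀ r, Integrable fun v : R3 => G (‖v‖ ^ 2 / 2 + r))
    (hne : ∀ r, ∃ v : R3, F (‖v‖ ^ 2 / 2 + y) ≠ G (‖v‖ ^ 2 / 2 + r)) :
    ∃ m, 0 < m ∧ ∀ r, m ≤ ∫ v : R3, |F (‖v‖ ^ 2 / 2 + y) - G (‖v‖ ^ 2 / 2 + r)| := by
  let w : R3 → ℝ := fun v => (1 + ‖v‖ ^ 2) ^ (-(4 : ℝ) / 2)
  have hwi : Integrable w := integrable_rpow_neg_one_add_norm_sq (by simp; norm_num)
  have hwpos (v : R3) : 0 < w v := by positivity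
  have hwle (v : R3) : w v ≤ 1 :=
    Real.rpow_le_one_of_one_le_of_nonpos (by linarith [sq_nonneg ‖v‖]) (by norm_num)
  have hwc : Continuous w := Continuous.rpow_const (by fun_prop) fun v => Or.inl (by positivity)
  let D : ℝ → R3 → ℝ := fun r v => |F (‖v‖ ^ 2 / 2 + y) - G (‖v‖ ^ 2 / 2 + r)|
  have hDi (r : ℝ) : Integrable (D r) := (hFi.sub (hGi r)).abs
  have hDc (r : ℝ) : Continuous (D r) := by fun_prop
  have hwD (r : ℝ) (v : R3) : w v * D r v ≤ D r v :=
    mul_le_of_le_one_left (abs_nonneg _) (hwle v)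
  have hwDi (r : ℝ) : Integrable fun v => w v * D r v :=
    (hDi r).mono' (by fun_prop) (Eventually.of_forall fun v => by
      rw [Real.norm_of_nonneg (mul_nonneg (hwpos v).le (abs_nonneg _))]
      exact hwD r v)
  have hbound (r : ℝ) (v : R3) : ‖w v * D r v‖ ≤ w v * (M + N) := by
    rw [Real.norm_of_nonneg (mul_nonneg (hwpos v).le (abs_nonneg _))]
    exact mul_le_mul_of_nonneg_left ((abs_sub _ _).trans (add_le_add (hM _) (hN _))) (hwpos v).le
  have hJ : Continuous fun r => ∫ v, w v * D r v :=
    continuous_of_dominated (fun r => (hwDi r).aestronglyMeasurable)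
      (fun r => Eventually.of_forall (hbound r)) (hwi.mul_const _)
      (Eventually.of_forall fun v => by fun_prop)
  have hJpos (r : ℝ) : 0 < ∫ v, w v * D r v := by
    obtain ⟨v, hv⟩ := hne r
    exact integral_pos_of_integrable_nonneg_nonzero (hwc.mul (hDc r)) (hwDi r)
      (fun v => mul_nonneg (hwpos v).le (abs_nonneg _)) (x := v)
      (mul_ne_zero (hwpos v).ne' (abs_ne_zero.2 (sub_ne_zero.2 hv)))
  have hlim : Tendsto (fun r => ∫ v, w v * D r v) (cocompact ℝ)
      (𝓝 (∫ v, w v * F (‖v‖ ^ 2 / 2 + y))) := by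
    have hlim_of_le (l : Filter ℝ) [l.IsCountablyGenerated] (hl : l ≤ cocompact ℝ) :
        Tendsto (fun r => ∫ v, w v * D r v) l (𝓝 (∫ v, w v * F (‖v‖ ^ 2 / 2 + y))) := by
      refine tendsto_integral_filter_of_dominated_convergence (fun v => w v * (M + N))
        (Eventually.of_forall fun r => (hwDi r).aestronglyMeasurable)
        (Eventually.of_forall fun r => Eventually.of_forall (hbound r)) (hwi.mul_const _)
        (Eventually.of_forall fun v => ?_)
      have htrans : Tendsto (fun r => G (‖v‖ ^ 2 / 2 + r)) (cocompact ℝ) (𝓝 0) :=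
        hG0.comp (Homeomorph.addLeft (‖v‖ ^ 2 / 2)).isClosedEmbedding.tendsto_cocompact
      have h := ((htrans.const_sub (F (‖v‖ ^ 2 / 2 + y))).abs).const_mul (w v)
      rw [sub_zero, abs_of_pos (hFpos _)] at h
      exact h.mono_left hl
    rw [cocompact_eq_atBot_atTop]
    exact (hlim_of_le _ atBot_le_cocompact).sup (hlim_of_le _ atTop_le_cocompact)
  have hwFi : Integrable fun v : R3 => w v * F (‖v‖ ^ 2 / 2 + y) :=
    hFi.mono (by fun_prop) (Eventually.of_forall fun v => by
      rw [norm_mul, Real.norm_of_nonneg (hwpos v).le]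
      exact mul_le_of_le_one_left (norm_nonneg _) (hwle v))
  have hL : 0 < ∫ v : R3, w v * F (‖v‖ ^ 2 / 2 + y) :=
    integral_pos_of_integrable_nonneg_nonzero (by fun_prop) hwFi
      (fun v => (mul_pos (hwpos v) (hFpos _)).le) (x := 0) (mul_pos (hwpos 0) (hFpos _)).ne'
  obtain ⟨m, hm, hmle⟩ := exists_pos_forall_le_of_tendsto_cocompact hJ hJpos hL hlim
  exact ⟨m, hm, fun r => (hmle r).trans (integral_mono (hwDi r) (hDi r) (hwD r))⟩

theorem lintegral_abs_sub_pos {F G : ℝ → ℝ} (hF : Continuous F) (hG : Continuous G)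
    (hne : ∀ y < 0, ∀ r, ∃ v : R3, F (‖v‖ ^ 2 / 2 + y) ≠ G (‖v‖ ^ 2 / 2 + r))
    {Q₁ Q₂ : R3 → ℝ} (hQ₁ : Measurable Q₁) (hQ₂ : Measurable Q₂)
    (hneg : 0 < (volume : Measure R3) {x : R3 | Q₁ x < 0}) :
    0 < ∫⁻ p : R3 × R3, ENNReal.ofReal
      |F (‖p.2‖ ^ 2 / 2 + Q₁ p.1) - G (‖p.2‖ ^ 2 / 2 + Q₂ p.1)| := by
  have hFm := hF.measurable
  have hGm := hG.measurable
  refine pos_iff_ne_zero.2 fun h0 => hneg.ne' ?_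
  rw [lintegral_eq_zero_iff (by fun_prop)] at h0
  have hnonneg : ∀ᵐ x : R3, ¬ Q₁ x < 0 := by
    filter_upwards [Measure.ae_ae_of_ae_prod h0] with x hx hx0
    obtain ⟨v, hv⟩ := hne _ hx0 (Q₂ x)
    refine hv (congrFun (Continuous.ae_eq_iff_eq volume
      (f := fun v : R3 => F (‖v‖ ^ 2 / 2 + Q₁ x)) (g := fun v : R3 => G (‖v‖ ^ 2 / 2 + Q₂ x))
      (by fun_prop) (by fun_prop) |>.1 ?_) v)
    filter_upwards [hx] with u hu
    exact sub_eq_zero.1 (abs_nonpos_iff.1 (ENNReal.ofReal_eq_zero.1 hu))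
  simpa [ae_iff] using hnonneg

/-- Steps 2–3 of Proposition 4.1: for β₁ < β₂, the extensions F₁ = F_{β₁,c} and
F₂ = F_{β₂,c} satisfy inf_{r∈ℝ} ∫ |F₁(½|v|²+y) − F₂(½|v|²+r)| dv > 0 for every y < 0;
consequently, if Q₁ < 0 on a set of positive measure, the densities
fᵢ(x,v) = Fᵢ(½|v|² + Qᵢ(x)) differ on a set of positive measure. -/
theorem densities_differ
    (F0 F0' : ℝ → ℝ) (β₁ β₂ c : ℝ)
    (hF0 : AssumptionA F0 F0')
    (h1 : 0 < β₁) (h12 : β₁ < β₂) (h2 : β₂ < 1 / 2) (hc : 0 < c) :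
    (∀ y : ℝ, y < 0 →
      0 < ⨅ r : ℝ, ∫ v : R3,
        |Fbc F0 F0' β₁ c (‖v‖ ^ 2 / 2 + y) - Fbc F0 F0' β₂ c (‖v‖ ^ 2 / 2 + r)|) ∧
    ∀ Q₁ Q₂ : R3 → ℝ, Measurable Q₁ → Measurable Q₂ →
      0 < (volume : Measure R3) {x : R3 | Q₁ x < 0} →
      0 < ∫⁻ p : R3 × R3, ENNReal.ofReal
        |Fbc F0 F0' β₁ c (‖p.2‖ ^ 2 / 2 + Q₁ p.1) -
          Fbc F0 F0' β₂ c (‖p.2‖ ^ 2 / 2 + Q₂ p.1)| := by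
  have hβ₂ := h1.trans h12
  refine ⟨fun y hy => ?_, fun Q₁ Q₂ hQ₁ hQ₂ hneg => ?_⟩
  · obtain ⟨M, hM⟩ := hF0.Fbc_bounded h1 hc
    obtain ⟨N, hN⟩ := hF0.Fbc_bounded hβ₂ hc
    obtain ⟨m, hm, hle⟩ := exists_pos_le_integral_abs_sub (hF0.Fbc_continuous β₁ c)
      (hF0.Fbc_continuous β₂ c) (hF0.Fbc_pos hc) hM hN (hF0.tendsto_Fbc_cocompact hβ₂ hc) y
      (hF0.integrable_Fbc_kinetic β₁ c y) (hF0.integrable_Fbc_kinetic β₂ c)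
      (hF0.exists_Fbc_kinetic_ne h12 hc hy)
    exact hm.trans_le (le_ciInf hle)
  · exact lintegral_abs_sub_pos (hF0.Fbc_continuous β₁ c) (hF0.Fbc_continuous β₂ c)
      (fun y hy => hF0.exists_Fbc_kinetic_ne h12 hc hy) hQ₁ hQ₂ hneg

end
end
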